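/- The series of squared binomial coefficients satisfies ∑_{k=0}^∞ binom(1/2, k)² = 4/π; equivalently, (1/2π) ∫_0^{2π} |2 cos(t/2)| dt = 4/π. -/

import Mathlib

open Finset

/-- The generalized binomial coefficient `binom(1/2, k) = (1/2)(1/2-1)⋯(1/2-k+1)/k!`. -/
noncomputable def halfChoose (k : ℕ) : ℝ :=
  (∏ i ∈ Finset.range k, ((1 : ℝ) / 2 - i)) / (k.factorial : ℝ)

open Filter Topology

/-- The `k`-th term of Gauss's series `₂F₁(-1/2, -1/2; m + 1; 1)`. -/
noncomputable def gaussTerm (m k : ℕ) : ℝ :=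
  ∏ i ∈ range k, ((1 : ℝ) / 2 - i) ^ 2 / ((m + 1 + i) * (i + 1))

lemma gaussTerm_zero (m : ℕ) : gaussTerm m 0 = 1 := by simp [gaussTerm]

lemma gaussTerm_succ (m k : ℕ) :
    gaussTerm m (k + 1) = gaussTerm m k * (((1 : ℝ) / 2 - k) ^ 2 / ((m + 1 + k) * (k + 1))) :=
  prod_range_succ _ _

lemma gaussTerm_nonneg (m k : ℕ) : 0 ≤ gaussTerm m k :=
  prod_nonneg fun _ _ => by positivity

lemma halfChoose_sq (k : ℕ) : halfChoose k ^ 2 = gaussTerm 0 k := by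
  induction k with
  | zero => simp [halfChoose, gaussTerm]
  | succ k ih =>
    have hk : (k.factorial : ℝ) ≠ 0 := by positivity
    rw [gaussTerm_succ, ← ih, halfChoose, halfChoose, prod_range_succ, Nat.factorial_succ]
    push_cast
    field_simp
    ring

lemma gaussTerm_zero_succ_le (k : ℕ) :
    gaussTerm 0 (k + 1) ≤ 1 / (2 * (((k : ℝ) + 1) * (k + 2))) := by
  induction k with
  | zero => norm_num [gaussTerm]
  | succ k ih =>
    rw [gaussTerm_succ]
    refine (mul_le_mul_of_nonneg_right ih (by positivity)).trans ?_
    push_cast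
    rw [div_mul_div_comm, div_le_div_iff₀ (by positivity) (by positivity)]
    have hk : (0 : ℝ) ≤ k := k.cast_nonneg
    have h : (1 / 2 - ((k : ℝ) + 1)) ^ 2 * (k + 3) ≤ (k + 1) * (k + 2) ^ 2 := by nlinarith
    nlinarith [mul_le_mul_of_nonneg_left h (show (0 : ℝ) ≤ 2 * (k + 2) by positivity)]

lemma gaussTerm_mul_succ_le (m k : ℕ) :
    gaussTerm m (k + 1) * (m + 1) ≤ gaussTerm 0 (k + 1) := by
  induction k with
  | zero =>
    have : (m : ℝ) + 1 ≠ 0 := by positivity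
    simp [gaussTerm, this]
  | succ k ih =>
    rw [gaussTerm_succ m, gaussTerm_succ 0, mul_right_comm]
    refine mul_le_mul ih ?_ (by positivity) (gaussTerm_nonneg _ _)
    gcongr
    simp

lemma gaussTerm_le (m k : ℕ) : gaussTerm m k ≤ gaussTerm 0 k := by
  refine prod_le_prod (fun _ _ => by positivity) fun i _ => ?_
  gcongr
  simp

lemma summable_gaussTerm (m : ℕ) : Summable (gaussTerm m) := by
  refine Summable.of_nonneg_of_le (gaussTerm_nonneg m) (gaussTerm_le m) ?_
  rw [← summable_nat_add_iff 1]
  refine Summable.of_nonneg_of_le (fun k => gaussTerm_nonneg 0 _) (fun k => ?_)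
    ((summable_nat_add_iff 1).2 (Real.summable_one_div_nat_pow.2 one_lt_two))
  refine (gaussTerm_zero_succ_le k).trans ?_
  push_cast
  gcongr
  have hk : (0 : ℝ) ≤ k := k.cast_nonneg
  nlinarith

lemma tendsto_mul_gaussTerm (m : ℕ) :
    Tendsto (fun k : ℕ => (k : ℝ) * gaussTerm m k) atTop (𝓝 0) := by
  rw [← tendsto_add_atTop_iff_nat 1]
  refine squeeze_zero (fun k => mul_nonneg (by positivity) (gaussTerm_nonneg _ _)) (fun k => ?_)
    tendsto_one_div_add_atTop_nhds_zero_nat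
  refine (mul_le_mul_of_nonneg_left ((gaussTerm_le m _).trans (gaussTerm_zero_succ_le k))
    (by positivity)).trans ?_
  push_cast
  rw [mul_one_div, div_le_div_iff₀ (by positivity) (by positivity)]
  have hk : (0 : ℝ) ≤ k := k.cast_nonneg
  nlinarith [mul_nonneg hk hk]

lemma gaussTerm_succ_left (m k : ℕ) :
    gaussTerm (m + 1) k = gaussTerm m k * ((m + 1) / (m + 1 + k)) := by
  induction k with
  | zero =>
    have : (m : ℝ) + 1 ≠ 0 := by positivity
    simp [gaussTerm, this]
  | succ k ih =>
    rw [gaussTerm_succ, gaussTerm_succ, ih]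
    push_cast
    field_simp
    ring

/-- The telescoping certificate behind Gauss's contiguous relation at `1`. -/
lemma gaussTerm_sub (m k : ℕ) :
    gaussTerm m k - (2 * m + 3) ^ 2 / ((2 * m + 2) * (2 * m + 4)) * gaussTerm (m + 1) k =
      -1 / (m + 2) * (((k + 1 : ℕ) : ℝ) * gaussTerm m (k + 1)) -
        -1 / (m + 2) * ((k : ℝ) * gaussTerm m k) := by
  rw [gaussTerm_succ_left, gaussTerm_succ]
  have h₁ : (m : ℝ) + 1 + k ≠ 0 := by positivity
  have h₂ : (m : ℝ) + 2 ≠ 0 := by positivity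
  have h₃ : (2 * m : ℝ) + 2 ≠ 0 := by positivity
  have h₄ : (2 * m : ℝ) + 4 ≠ 0 := by positivity
  push_cast
  field_simp
  ring

lemma tsum_gaussTerm_eq (m : ℕ) :
    ∑' k, gaussTerm m k =
      (2 * m + 3) ^ 2 / ((2 * m + 2) * (2 * m + 4)) * ∑' k, gaussTerm (m + 1) k := by
  have h := ((summable_gaussTerm m).hasSum.sub ((summable_gaussTerm (m + 1)).hasSum.mul_left
    ((2 * m + 3 : ℝ) ^ 2 / ((2 * m + 2) * (2 * m + 4))))).tendsto_sum_nat
  simp_rw [gaussTerm_sub,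
    sum_range_sub (fun k : ℕ => -1 / ((m : ℝ) + 2) * ((k : ℝ) * gaussTerm m k))] at h
  have h' := ((tendsto_mul_gaussTerm m).const_mul (-1 / ((m : ℝ) + 2))).sub_const
    (-1 / ((m : ℝ) + 2) * (((0 : ℕ) : ℝ) * gaussTerm m 0))
  have := tendsto_nhds_unique h h'
  simp only [Nat.cast_zero, zero_mul, mul_zero, sub_zero] at this
  linarith

lemma tsum_gaussTerm_mul_wallis (n : ℕ) :
    (∑' k, gaussTerm 0 k) * Real.Wallis.W n =
      (2 - 1 / ((n : ℝ) + 1)) * ∑' k, gaussTerm n k := by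
  induction n with
  | zero => norm_num [Real.Wallis.W]
  | succ n ih =>
    rw [Real.Wallis.W_succ, ← mul_assoc, ih, tsum_gaussTerm_eq n]
    push_cast
    field_simp
    ring

lemma tendsto_tsum_gaussTerm : Tendsto (fun m => ∑' k, gaussTerm m k) atTop (𝓝 1) := by
  have h : ∀ m, ∑' k, gaussTerm m k = 1 + ∑' k, gaussTerm m (k + 1) := fun m => by
    rw [(summable_gaussTerm m).tsum_eq_zero_add, gaussTerm_zero]
  have hs := fun m => (summable_nat_add_iff 1).2 (summable_gaussTerm m)
  simp_rw [h]
  suffices H : Tendsto (fun m => ∑' k, gaussTerm m (k + 1)) atTop (𝓝 0) by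
    simpa using H.const_add 1
  refine squeeze_zero (fun m => tsum_nonneg fun k => gaussTerm_nonneg _ _)
    (g := fun m : ℕ => (∑' k, gaussTerm 0 (k + 1)) * (1 / ((m : ℝ) + 1))) (fun m => ?_) ?_
  · rw [mul_one_div, le_div_iff₀ (by positivity), ← tsum_mul_right]
    exact ((hs m).mul_right _).tsum_le_tsum (gaussTerm_mul_succ_le m) (hs 0)
  · simpa using tendsto_one_div_add_atTop_nhds_zero_nat (𝕜 := ℝ) |>.const_mul
      (∑' k, gaussTerm 0 (k + 1))

lemma tsum_gaussTerm_zero : ∑' k, gaussTerm 0 k = 4 / Real.pi := by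
  have h₁ := Real.Wallis.tendsto_W_nhds_pi_div_two.const_mul (∑' k, gaussTerm 0 k)
  simp_rw [tsum_gaussTerm_mul_wallis] at h₁
  have h₀ := tendsto_one_div_add_atTop_nhds_zero_nat (𝕜 := ℝ)
  have h₂ := (h₀.const_sub 2).mul tendsto_tsum_gaussTerm
  have := tendsto_nhds_unique h₁ h₂
  rw [eq_div_iff Real.pi_ne_zero]
  linarith

lemma integral_abs_two_mul_cos_half :
    ∫ t in (0 : ℝ)..(2 * Real.pi), |2 * Real.cos (t / 2)| = 8 := by
  have hπ := Real.pi_pos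
  have hc : Continuous fun t : ℝ => |2 * Real.cos (t / 2)| := by fun_prop
  have hd : ∀ t : ℝ, HasDerivAt (fun t => 4 * Real.sin (t / 2)) (2 * Real.cos (t / 2)) t :=
    fun t => (((hasDerivAt_id' t).div_const 2).sin.const_mul 4).congr_deriv (by ring)
  have hi : ∀ a b : ℝ, ∫ t in a..b, 2 * Real.cos (t / 2) =
      4 * Real.sin (b / 2) - 4 * Real.sin (a / 2) := fun a b =>
    intervalIntegral.integral_eq_sub_of_hasDerivAt (fun t _ => hd t)
      (Continuous.intervalIntegrable (by fun_prop) _ _)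
  have h₁ : ∫ t in (0 : ℝ)..Real.pi, |2 * Real.cos (t / 2)| = 4 := by
    rw [intervalIntegral.integral_congr (g := fun t => 2 * Real.cos (t / 2)), hi]
    · simp
    · intro t ht
      rw [Set.uIcc_of_le hπ.le] at ht
      exact abs_of_nonneg (mul_nonneg two_pos.le
        (Real.cos_nonneg_of_mem_Icc ⟨by linarith [ht.1], by linarith [ht.2]⟩))
  have h₂ : ∫ t in Real.pi..(2 * Real.pi), |2 * Real.cos (t / 2)| = 4 := by
    rw [intervalIntegral.integral_congr (g := fun t => -(2 * Real.cos (t / 2))),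
      intervalIntegral.integral_neg, hi]
    · simp
    · intro t ht
      rw [Set.uIcc_of_le (by linarith)] at ht
      exact abs_of_nonpos (mul_nonpos_of_nonneg_of_nonpos two_pos.le
        (Real.cos_nonpos_of_pi_div_two_le_of_le (by linarith [ht.1]) (by linarith [ht.2])))
  rw [← intervalIntegral.integral_add_adjacent_intervals (hc.intervalIntegrable 0 Real.pi)
    (hc.intervalIntegrable _ _), h₁, h₂]
  norm_num

/-- `∑_{k=0}^∞ binom(1/2, k)² = 4/π`; equivalently,
`(1/2π) ∫_0^{2π} |2 cos(t/2)| dt = 4/π`. -/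
theorem sum_sq_half_binomial
    : HasSum (fun k : ℕ => (halfChoose k) ^ 2) (4 / Real.pi) ∧
      (1 / (2 * Real.pi)) * ∫ t in (0 : ℝ)..(2 * Real.pi), |2 * Real.cos (t / 2)| =
        4 / Real.pi := by
  constructor
  · simp_rw [halfChoose_sq, ← tsum_gaussTerm_zero]
    exact (summable_gaussTerm 0).hasSum
  · rw [integral_abs_two_mul_cos_half]
    field_simp
    norm_num
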